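/- arXiv:2108.04764 — 2 statements merged into one kernel-verified Lean document; each statement's English description precedes it below -/
import Mathlib

section
/- The minimum cardinality of an edge-forcing set of the 3-dimensional butterfly network BF(3) is exactly 8. -/
open SimpleGraph

/-- Zero-forcing closure: `ZFForced G S v` means `v` is eventually forced
starting from the initially-forced set `S`. A forced vertex `u` whose neighbors,
with the single exception of `v`, are all forced, forces `v`. -/
inductive ZFForced {V : Type*} (G : SimpleGraph V) (S : Set V) : V → Prop
  | init {v : V} : v ∈ S → ZFForced G S v
  | force {u v : V} : ZFForced G S u → G.Adj u v →
      (∀ w, G.Adj u w → w ≠ v → ZFForced G S w) → ZFForced G S v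

/-- `S` is a zero forcing set of `G` if its closure is all of `V`. -/
def IsZeroForcingSet {V : Type*} (G : SimpleGraph V) (S : Set V) : Prop :=
  ∀ v : V, ZFForced G S v

/-- `K` is an edge-forcing set of `G`: a set of pairwise non-adjacent
(vertex-disjoint) edges of `G` whose endpoint set is a zero forcing set. -/
def IsEdgeForcingSet {V : Type*} (G : SimpleGraph V) (K : Set (Sym2 V)) : Prop :=
  K ⊆ G.edgeSet ∧
  K.Pairwise (fun e f => ∀ v : V, v ∈ e → v ∉ f) ∧
  IsZeroForcingSet G {v : V | ∃ e ∈ K, v ∈ e}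

/-- The edge-forcing number: minimum cardinality of an edge-forcing set. -/
noncomputable def edgeForcingNumber {V : Type*} (G : SimpleGraph V) : ℕ :=
  sInf {n : ℕ | ∃ K : Set (Sym2 V), IsEdgeForcingSet G K ∧ K.ncard = n}

/-- The `r`-dimensional butterfly network: vertices `(w, i)` with
`w : Fin r → Bool` and level `i : Fin (r+1)`; `(w,i)` is adjacent to `(w',i+1)`
iff `w = w'` or `w` and `w'` differ exactly in bit `i+1` (index `i`, 0-based). -/
def butterfly (r : ℕ) : SimpleGraph ((Fin r → Bool) × Fin (r + 1)) :=
  SimpleGraph.fromRel (fun p q =>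
    (p.2 : ℕ) + 1 = (q.2 : ℕ) ∧
      (p.1 = q.1 ∨ ∀ k : Fin r, (p.1 k ≠ q.1 k ↔ (k : ℕ) = (p.2 : ℕ))))

abbrev BV : Type := (Fin 3 → Bool) × Fin 4

instance bfDec : DecidableRel (butterfly 3).Adj := fun a b =>
  decidable_of_iff (a ≠ b ∧
    (((a.2 : ℕ) + 1 = (b.2 : ℕ) ∧
      (a.1 = b.1 ∨ ∀ k : Fin 3, (a.1 k ≠ b.1 k ↔ (k : ℕ) = (a.2 : ℕ)))) ∨
     ((b.2 : ℕ) + 1 = (a.2 : ℕ) ∧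
      (b.1 = a.1 ∨ ∀ k : Fin 3, (b.1 k ≠ a.1 k ↔ (k : ℕ) = (b.2 : ℕ)))))) Iff.rfl

/-- The optimal matching. -/
def bfEdges : List (BV × BV) :=
  [((![false, false, false], 0), (![false, false, false], 1)),
   ((![false, true, false], 0), (![false, true, false], 1)),
   ((![false, false, true], 0), (![false, false, true], 1)),
   ((![false, true, true], 0), (![false, true, true], 1)),
   ((![false, false, false], 2), (![false, false, false], 3)),
   ((![true, false, false], 2), (![true, false, false], 3)),
   ((![false, true, false], 2), (![false, true, false], 3)),
   ((![true, true, false], 2), (![true, true, false], 3))]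

/-- The forces, in order. -/
def bfChain : List (BV × BV) :=
  [((![false, false, false], 1), (![true, false, false], 0)),
   ((![true, false, false], 3), (![true, false, true], 2)),
   ((![false, false, true], 0), (![true, false, true], 1)),
   ((![false, true, false], 1), (![true, true, false], 0)),
   ((![false, true, false], 2), (![false, true, true], 3)),
   ((![false, false, false], 0), (![true, false, false], 1)),
   ((![false, false, false], 3), (![false, false, true], 2)),
   ((![false, true, false], 0), (![true, true, false], 1)),
   ((![false, true, false], 3), (![false, true, true], 2)),
   ((![false, false, false], 2), (![false, false, true], 3)),
   ((![true, true, false], 3), (![true, true, true], 2)),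
   ((![false, true, true], 0), (![true, true, true], 1)),
   ((![true, true, false], 2), (![true, true, true], 3)),
   ((![false, false, true], 1), (![true, false, true], 0)),
   ((![true, true, true], 1), (![true, true, true], 0)),
   ((![true, false, false], 2), (![true, false, true], 3))]

def bfInit : List BV := bfEdges.flatMap fun p => [p.1, p.2]

/-- A list of forces is valid from the forced list `F` and reaches everything. -/
def bfValid : List BV → List (BV × BV) → Prop
  | F, [] => ∀ v : BV, v ∈ F
  | F, p :: l => p.1 ∈ F ∧ (butterfly 3).Adj p.1 p.2 ∧
      (∀ w : BV, (butterfly 3).Adj p.1 w → w ≠ p.2 → w ∈ F) ∧ bfValid (p.2 :: F) l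

instance bfValidDec : ∀ F l, Decidable (bfValid F l)
  | F, [] => inferInstanceAs (Decidable (∀ v : BV, v ∈ F))
  | F, p :: l =>
    have := bfValidDec (p.2 :: F) l
    inferInstanceAs (Decidable (p.1 ∈ F ∧ (butterfly 3).Adj p.1 p.2 ∧
      (∀ w : BV, (butterfly 3).Adj p.1 w → w ≠ p.2 → w ∈ F) ∧ bfValid (p.2 :: F) l))

lemma bfValid_forced (S : Set BV) : ∀ (l : List (BV × BV)) (F : List BV),
    (∀ v ∈ F, ZFForced (butterfly 3) S v) → bfValid F l → IsZeroForcingSet (butterfly 3) S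
  | [], _, hF, h => fun v => hF v (h v)
  | p :: l, F, hF, ⟨h1, h2, h3, h4⟩ => by
    refine bfValid_forced S l (p.2 :: F) ?_ h4
    intro v hv
    rcases List.mem_cons.1 hv with rfl | hv
    · exact ZFForced.force (hF _ h1) h2 fun w hw hne => hF _ (h3 w hw hne)
    · exact hF v hv

/-- Twins not meeting `S` can never be forced. -/
lemma twins_hit {V : Type*} (G : SimpleGraph V) (S : Set V) (a b : V) (hab : a ≠ b)
    (ht : ∀ u, G.Adj u a ↔ G.Adj u b) (h : IsZeroForcingSet G S) : a ∈ S ∨ b ∈ S := by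
  by_contra hc
  push Not at hc
  have key : ∀ v, ZFForced G S v → v ≠ a ∧ v ≠ b := by
    intro v hv
    induction hv with
    | init hm => exact ⟨fun e => hc.1 (e ▸ hm), fun e => hc.2 (e ▸ hm)⟩
    | force _ hadj _ _ ih =>
      constructor
      · rintro rfl
        exact (ih b ((ht _).1 hadj) hab.symm).2 rfl
      · rintro rfl
        exact (ih a ((ht _).2 hadj) hab).1 rfl
  exact (key a (h a)).1 rfl

/-- The eight twin pairs. -/
def tw (s : Bool) (x : Bool × Bool) (c : Bool) : BV :=
  if s then (![x.1, x.2, c], 3) else (![c, x.1, x.2], 0)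

lemma tw_twins : ∀ s x, ∀ u : BV,
    (butterfly 3).Adj u (tw s x false) ↔ (butterfly 3).Adj u (tw s x true) := by
  decide +kernel

lemma tw_inj : ∀ s x c s' x' c', tw s x c = tw s' x' c' → s = s' ∧ x = x' := by
  decide +kernel

lemma tw_not_adj : ∀ s x c s' x' c', ¬ (butterfly 3).Adj (tw s x c) (tw s' x' c') := by
  decide +kernel

lemma bf_lower (K : Set (Sym2 BV)) (h : IsEdgeForcingSet (butterfly 3) K) : 8 ≤ K.ncard := by
  obtain ⟨hE, -, hZ⟩ := h
  have hex : ∀ i : Bool × (Bool × Bool), ∃ e ∈ K, ∃ c, tw i.1 i.2 c ∈ e := by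
    intro i
    have hne : tw i.1 i.2 false ≠ tw i.1 i.2 true := by revert i; decide +kernel
    rcases twins_hit _ _ _ _ hne (tw_twins i.1 i.2) hZ with ⟨e, he, hm⟩ | ⟨e, he, hm⟩
    · exact ⟨e, he, _, hm⟩
    · exact ⟨e, he, _, hm⟩
  choose f hf c hc using hex
  have hinj : Function.Injective f := by
    intro i j hij
    have h1 := hc i
    have h2 := hc j
    rw [← hij] at h2
    by_cases heq : tw i.1 i.2 (c i) = tw j.1 j.2 (c j)
    · have := tw_inj _ _ _ _ _ _ heq
      exact Prod.ext this.1 this.2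
    · have h3 := (Sym2.mem_and_mem_iff heq).1 ⟨h1, h2⟩
      have h4 := hE (hf i)
      rw [h3, SimpleGraph.mem_edgeSet] at h4
      exact absurd h4 (tw_not_adj _ _ _ _ _ _)
  have hsub : Set.range f ⊆ K := by
    rintro _ ⟨i, rfl⟩
    exact hf i
  have hcard : (Set.range f).ncard = 8 := by
    rw [← Set.image_univ, Set.ncard_image_of_injective _ hinj, Set.ncard_univ]
    simp
  rw [← hcard]
  exact Set.ncard_le_ncard hsub (Set.toFinite K)

def bfSet : Finset (Sym2 BV) := (bfEdges.map fun p => s(p.1, p.2)).toFinset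

lemma bf_upper : IsEdgeForcingSet (butterfly 3) (bfSet : Set (Sym2 BV)) := by
  refine ⟨?_, ?_, ?_⟩
  · intro e he
    simp only [bfSet, List.coe_toFinset, List.mem_map, Set.mem_setOf_eq] at he
    obtain ⟨p, hp, rfl⟩ := he
    rw [SimpleGraph.mem_edgeSet]
    revert p
    decide +kernel
  · intro e he e' he'
    simp only [bfSet, List.coe_toFinset, List.mem_map, Set.mem_setOf_eq] at he he'
    obtain ⟨p, hp, rfl⟩ := he
    obtain ⟨q, hq, rfl⟩ := he'
    have key : ∀ p ∈ bfEdges, ∀ q ∈ bfEdges, p ≠ q →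
        p.1 ≠ q.1 ∧ p.1 ≠ q.2 ∧ p.2 ≠ q.1 ∧ p.2 ≠ q.2 := by decide +kernel
    intro hne v hv hv'
    have hpq : p ≠ q := by
      rintro rfl
      exact hne rfl
    obtain ⟨h1, h2, h3, h4⟩ := key p hp q hq hpq
    simp only [Sym2.mem_iff] at hv hv'
    grind
  · refine bfValid_forced _ bfChain bfInit ?_ (by decide +kernel)
    intro v hv
    apply ZFForced.init
    simp only [bfInit, List.mem_flatMap, List.mem_cons, List.not_mem_nil, or_false] at hv
    obtain ⟨p, hp, hv⟩ := hv
    refine ⟨s(p.1, p.2), ?_, by simpa using hv⟩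
    simp only [bfSet, List.coe_toFinset, List.mem_map, Set.mem_setOf_eq]
    exact ⟨p, hp, rfl⟩

theorem edgeForcingNumber_BF3 : edgeForcingNumber (butterfly 3) = 8 := by
  have hle : (bfSet : Set (Sym2 BV)).ncard ≤ 8 := by
    rw [Set.ncard_coe_finset]
    exact (List.toFinset_card_le _).trans (by simp [bfEdges])
  have h8 : (bfSet : Set (Sym2 BV)).ncard = 8 := le_antisymm hle (bf_lower _ bf_upper)
  apply le_antisymm
  · exact Nat.sInf_le ⟨_, bf_upper, h8⟩
  · refine le_csInf ⟨8, _, bf_upper, h8⟩ ?_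
    rintro n ⟨K, hK, rfl⟩
    exact bf_lower K hK
end

section
/- The edge-forcing number of the 4-dimensional butterfly network BF(4) is exactly 25. -/
open SimpleGraph

namespace BF4

/-- Vertex with code `n = w + 16 * level`. -/
def dec (n : ℕ) : (Fin 4 → Bool) × Fin (4 + 1) :=
  (fun k => n.testBit k, ⟨n / 16 % 5, Nat.mod_lt _ (by norm_num)⟩)

/-- Code of a vertex. -/
def enc (v : (Fin 4 → Bool) × Fin (4 + 1)) : ℕ :=
  (v.1 0).toNat + 2 * (v.1 1).toNat + 4 * (v.1 2).toNat + 8 * (v.1 3).toNat + 16 * v.2.val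

/-- Codes of the neighbours of the vertex with code `m`. -/
def nbs (m : ℕ) : Finset ℕ :=
  (if m < 64 then {m + 16, (m ^^^ 2 ^ (m / 16)) + 16} else ∅) ∪
  (if 16 ≤ m then {m - 16, (m - 16) ^^^ 2 ^ (m / 16 - 1)} else ∅)

/-- The vertex is on an odd level. -/
def oddLevel (m : ℕ) : Bool := m.testBit 4

/-- A basis (as bitmasks) of the kernel of the adjacency matrix mod 2 on the even levels. -/
def masks : List ℕ :=
  [963362762716565395775497, 963362762716565395775498, 12, 963362762717338489888912,
   963362762717338489888928, 192, 224300372109568, 224300372109824, 3072, 12288, 49152,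
   401401151131902248222720, 802802302263804496445440, 401401151132224370769920,
   802802302264448741539840, 93458488360960, 186916976721920, 4740813226943354765312,
   9481626453886709530624, 18963252907773419061248, 37926505815546838122496,
   75853011631093676244992, 151706023262187352489984, 303412046524374704979968,
   606824093048749409959936]

/-- Coordinates dual to the basis. -/
def pivots : List ℕ :=
  [0, 1, 2, 4, 5, 6, 8, 9, 10, 12, 14, 32, 33, 36, 37, 40, 41, 64, 65, 66, 67, 68, 69, 70, 71]

/-- The edge-forcing set. -/
def edges : List (ℕ × ℕ) :=
  [(0, 16), (2, 18), (4, 20), (6, 22), (8, 24), (10, 26), (44, 28), (14, 30), (32, 48), (33, 49),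
   (38, 50), (67, 51), (68, 52), (69, 53), (70, 54), (71, 55), (64, 56), (40, 60), (15, 31), (78,
   62), (43, 59), (77, 61), (12, 29), (66, 58), (65, 57)]

/-- The chronological list of forces. -/
def forces : List (ℕ × ℕ) :=
  [(0, 17), (2, 19), (4, 21), (6, 23), (8, 25), (10, 27), (30, 46), (43, 63), (53, 37), (54, 34),
   (56, 72), (60, 76), (62, 42), (16, 1), (17, 35), (18, 3), (24, 9), (25, 41), (26, 11), (28,
   13), (48, 36), (49, 73), (50, 74), (57, 45), (20, 5), (21, 39), (22, 7), (29, 47), (51, 75),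
   (55, 79)]

def fvec (i : Fin 25) (n : ℕ) : ZMod 2 := if (masks.getD i 0).testBit n then 1 else 0

theorem dec_enc : ∀ v, dec (enc v) = v := by decide +kernel
theorem enc_lt : ∀ v, enc v < 80 := by decide +kernel
theorem enc_dec : ∀ n < 80, enc (dec n) = n := by decide +kernel

instance : DecidableRel (butterfly 4).Adj := by
  unfold butterfly; infer_instance

theorem adj_dec : ∀ m < 80, ∀ n < 80, ((butterfly 4).Adj (dec m) (dec n) ↔ n ∈ nbs m) := by
  decide +kernel

theorem nbs_lt : ∀ m < 80, ∀ n ∈ nbs m, n < 80 := by decide +kernel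
theorem nbs_odd : ∀ m < 80, ∀ n ∈ nbs m, oddLevel m = true ∨ oddLevel n = true := by
  decide +kernel
theorem fvec_odd : ∀ i, ∀ n < 80, oddLevel n = true → fvec i n = 0 := by decide +kernel
theorem nbs_even : ∀ m < 80, ∀ n ∈ nbs m, oddLevel m = false → oddLevel n = true := by
  decide +kernel
theorem fvec_sum : ∀ i, ∀ m < 80, oddLevel m = true → ∑ n ∈ nbs m, fvec i n = 0 := by
  decide +kernel
def piv (j : Fin 25) : ℕ := pivots.getD j 0

theorem fvec_pivot : ∀ i j : Fin 25, fvec i (piv j) = if i = j then 1 else 0 := by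
  decide +kernel
theorem pivots_lt : ∀ j : Fin 25, piv j < 80 := by decide +kernel

theorem adj_iff (u v) : (butterfly 4).Adj u v ↔ enc v ∈ nbs (enc u) := by
  have h := adj_dec (enc u) (enc_lt u) (enc v) (enc_lt v)
  rwa [dec_enc, dec_enc] at h

/-- Linear combination of the kernel vectors. -/
def comb (c : Fin 25 → ZMod 2) (n : ℕ) : ZMod 2 := ∑ i, c i * fvec i n

theorem comb_piv (c) (j : Fin 25) : comb c (piv j) = c j := by
  unfold comb
  simp only [fvec_pivot, mul_ite, mul_one, mul_zero, Finset.sum_ite_eq', Finset.mem_univ,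
    if_true]

theorem comb_odd (c) (n : ℕ) (hn : n < 80) (h : oddLevel n = true) : comb c n = 0 := by
  unfold comb
  exact Finset.sum_eq_zero fun i _ => by rw [fvec_odd i n hn h, mul_zero]

theorem comb_sum (c) (m : ℕ) (hm : m < 80) (h : oddLevel m = true) :
    ∑ n ∈ nbs m, comb c n = 0 := by
  unfold comb
  rw [Finset.sum_comm]
  exact Finset.sum_eq_zero fun i _ => by rw [← Finset.mul_sum, fvec_sum i m hm h, mul_zero]

theorem comb_forced (c) (S : Set ((Fin 4 → Bool) × Fin (4 + 1)))
    (hS : ∀ v ∈ S, comb c (enc v) = 0) (v) (hv : ZFForced (butterfly 4) S v) :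
    comb c (enc v) = 0 := by
  induction hv with
  | init h => exact hS _ h
  | @force u v _ huv _ _ ih =>
    have hmem := (adj_iff u v).1 huv
    by_cases ho : oddLevel (enc u) = true
    · rw [← comb_sum c (enc u) (enc_lt u) ho]
      symm
      apply Finset.sum_eq_single_of_mem _ hmem
      intro n hn hne
      have hlt := nbs_lt _ (enc_lt u) n hn
      have := ih (dec n) ((adj_iff _ _).2 (by rwa [enc_dec n hlt]))
        (fun h => hne (by rw [← h, enc_dec n hlt]))
      rwa [enc_dec n hlt] at this
    · exact comb_odd c _ (enc_lt v) (nbs_even _ (enc_lt u) _ hmem (by simpa using ho))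

/-- Evaluation of a kernel vector on an unordered pair. -/
def edgeVal (c : Fin 25 → ZMod 2) (e : Sym2 ((Fin 4 → Bool) × Fin (4 + 1))) : ZMod 2 :=
  Sym2.lift ⟨fun x y => comb c (enc x) + comb c (enc y), fun _ _ => add_comm _ _⟩ e

theorem lower (K : Set (Sym2 ((Fin 4 → Bool) × Fin (4 + 1))))
    (hK : IsEdgeForcingSet (butterfly 4) K) : 25 ≤ K.ncard := by
  classical
  obtain ⟨hE, -, hZ⟩ := hK
  have : Fintype K := Fintype.ofFinite K
  let Φ : (Fin 25 → ZMod 2) →ₗ[ZMod 2] (K → ZMod 2) :=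
    { toFun := fun c e => edgeVal c e.1
      map_add' := by
        rintro c d
        funext ⟨e, he⟩
        induction e with | _ x y =>
        simp only [edgeVal, Sym2.lift_mk, comb, Pi.add_apply, add_mul, Finset.sum_add_distrib]
        ring
      map_smul' := by
        rintro r c
        funext ⟨e, he⟩
        induction e with | _ x y =>
        simp only [edgeVal, Sym2.lift_mk, comb, Pi.smul_apply, smul_eq_mul, mul_assoc,
          ← Finset.mul_sum, RingHom.id_apply]
        ring }
  have hinj : Function.Injective Φ := by
    rw [injective_iff_map_eq_zero]
    intro c hc
    have hS : ∀ v ∈ {v | ∃ e ∈ K, v ∈ e}, comb c (enc v) = 0 := by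
      rintro v ⟨e, he, hve⟩
      obtain ⟨y, rfl⟩ := hve
      have h0 : comb c (enc v) + comb c (enc y) = 0 := congrFun hc ⟨_, he⟩
      have hadj := (adj_iff v y).1 (hE he)
      rcases nbs_odd _ (enc_lt v) _ hadj with h | h
      · exact comb_odd c _ (enc_lt v) h
      · rwa [comb_odd c _ (enc_lt y) h, add_zero] at h0
    funext j
    have h := comb_forced c _ hS _ (hZ (dec (piv j)))
    rw [enc_dec _ (pivots_lt j), comb_piv] at h
    exact h
  have := LinearMap.finrank_le_finrank_of_injective hinj
  rw [Module.finrank_fintype_fun_eq_card, Module.finrank_fintype_fun_eq_card,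
    Fintype.card_fin] at this
  rwa [← Nat.card_coe_set_eq, Nat.card_eq_fintype_card]

/-- Verifier for a list of forces from a list of forced codes. -/
def verify : List (ℕ × ℕ) → List ℕ → Bool
  | [], L => decide (∀ n ∈ List.range 80, n ∈ L)
  | (u, v) :: r, L =>
    decide (u < 80 ∧ v < 80 ∧ u ∈ L ∧ v ∈ nbs u ∧ ∀ w ∈ nbs u, w ≠ v → w ∈ L) && verify r (v :: L)

theorem verify_sound (S : Set ((Fin 4 → Bool) × Fin (4 + 1))) :
    ∀ (r : List (ℕ × ℕ)) (L : List ℕ), verify r L = true →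
      (∀ n ∈ L, ZFForced (butterfly 4) S (dec n)) → IsZeroForcingSet (butterfly 4) S
  | [], L, h, hL => by
    intro v
    have h' : ∀ n < 80, n ∈ L := by simpa [verify] using h
    have := hL _ (h' _ (enc_lt v))
    rwa [dec_enc] at this
  | (u, v) :: r, L, h, hL => by
    rw [verify, Bool.and_eq_true, decide_eq_true_eq] at h
    obtain ⟨⟨hu, hv, huL, hvu, hw⟩, hr⟩ := h
    refine verify_sound S r (v :: L) hr ?_
    intro n hn
    rcases List.mem_cons.1 hn with rfl | hn
    · refine ZFForced.force (hL u huL) ((adj_dec u hu n hv).2 hvu) ?_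
      intro w haw hne
      have h1 := (adj_iff _ _).1 haw
      rw [enc_dec u hu] at h1
      have := hL _ (hw (enc w) h1 (fun h => hne (by rw [← h, dec_enc])))
      rwa [dec_enc] at this
    · exact hL n hn

def ea (i : Fin 25) : ℕ := (edges.getD i (0, 0)).1
def eb (i : Fin 25) : ℕ := (edges.getD i (0, 0)).2

theorem e_lt : ∀ i, ea i < 80 ∧ eb i < 80 ∧ eb i ∈ nbs (ea i) := by decide +kernel
theorem e_disj : ∀ i j, i ≠ j → ea i ≠ ea j ∧ eb i ≠ eb j ∧ ea i ≠ eb j ∧ eb i ≠ ea j := by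
  decide +kernel
theorem verify_edges : verify forces (List.ofFn ea ++ List.ofFn eb) = true := by decide +kernel

def edge (i : Fin 25) : Sym2 ((Fin 4 → Bool) × Fin (4 + 1)) := s(dec (ea i), dec (eb i))

theorem dec_inj {m n : ℕ} (hm : m < 80) (hn : n < 80) (h : dec m = dec n) : m = n := by
  rw [← enc_dec m hm, h, enc_dec n hn]

theorem edge_disj (i j : Fin 25) (hij : i ≠ j) (v) (hi : v ∈ edge i) : v ∉ edge j := by
  intro hj
  obtain ⟨h1, h2, h3, h4⟩ := e_disj i j hij
  obtain ⟨ai, bi, -⟩ := e_lt i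
  obtain ⟨aj, bj, -⟩ := e_lt j
  rcases Sym2.mem_iff.1 hi with rfl | rfl <;> rcases Sym2.mem_iff.1 hj with h | h
  · exact h1 (dec_inj ai aj h)
  · exact h3 (dec_inj ai bj h)
  · exact h4 (dec_inj bi aj h)
  · exact h2 (dec_inj bi bj h)

theorem edge_inj : Function.Injective edge := by
  intro i j h
  by_contra hij
  exact edge_disj i j hij _ (Sym2.mem_mk_left _ _) (h ▸ Sym2.mem_mk_left _ _)

theorem upper : IsEdgeForcingSet (butterfly 4) (Set.range edge) := by
  refine ⟨?_, ?_, ?_⟩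
  · rintro _ ⟨i, rfl⟩
    obtain ⟨ha, hb, hm⟩ := e_lt i
    exact (adj_dec _ ha _ hb).2 hm
  · rintro _ ⟨i, rfl⟩ _ ⟨j, rfl⟩ hne
    exact edge_disj i j fun h => hne (by rw [h])
  · refine verify_sound _ _ _ verify_edges ?_
    intro n hn
    apply ZFForced.init
    rw [List.mem_append, List.mem_ofFn, List.mem_ofFn] at hn
    rcases hn with ⟨i, rfl⟩ | ⟨i, rfl⟩
    · exact ⟨_, ⟨i, rfl⟩, Sym2.mem_mk_left _ _⟩
    · exact ⟨_, ⟨i, rfl⟩, Sym2.mem_mk_right _ _⟩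

end BF4

theorem edgeForcingNumber_BF4 : edgeForcingNumber (butterfly 4) = 25 := by
  have hmem : 25 ∈ {n : ℕ | ∃ K, IsEdgeForcingSet (butterfly 4) K ∧ K.ncard = n} := by
    refine ⟨_, BF4.upper, ?_⟩
    rw [← Set.image_univ, Set.ncard_image_of_injective _ BF4.edge_inj, Set.ncard_univ]
    simp
  apply le_antisymm
  · exact Nat.sInf_le hmem
  · refine le_csInf ⟨_, hmem⟩ ?_
    rintro n ⟨K, hK, rfl⟩
    exact BF4.lower K hK
end
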